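/- Let r ≥ 1 and let R = ℤ[x, y]/(x^{r+1}, y^{r+1}), with ε : R → ℤ the linear functional extracting the coefficient of x^r y^r. Let l₁, l₂, l₃ be integers with 1 ≤ lᵢ ≤ r and l₁ + l₂ + l₃ = 2r + 1. Then ε( (x^{l₁} - (-y)^{l₁}) · (x^{l₂} - (-y)^{l₂}) · Σ_{j=0}^{l₃-1} x^{l₃-1-j} (-y)^j ) = -2·(-1)^r. -/

import Mathlib

open MvPolynomial Finset

/-- In `R = ℤ[x,y]/(x^{r+1}, y^{r+1})`, the functional ε extracting the coefficient of
`x^r y^r` is computed on representatives of total degree `2r` by the coefficient of the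
monomial `x^r y^r` in `ℤ[x,y]` (the relations do not affect this coefficient). -/
noncomputable def eps3 (r : ℕ) (p : MvPolynomial (Fin 2) ℤ) : ℤ :=
  MvPolynomial.coeff (Finsupp.single 0 r + Finsupp.single 1 r) p

theorem eps3_X_pow_mul_neg_X_pow (r a b : ℕ) :
    eps3 r (X 0 ^ a * (-X 1) ^ b) = if a = r ∧ b = r then (-1) ^ r else 0 := by
  have h : (X 0 ^ a * (-X 1) ^ b : MvPolynomial (Fin 2) ℤ) =
      monomial (Finsupp.single 0 a + Finsupp.single 1 b) ((-1) ^ b) := by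
    rw [neg_pow, X_pow_eq_monomial, X_pow_eq_monomial, ← C_1, ← C_neg, ← C_pow,
      mul_left_comm, monomial_mul, C_mul_monomial]
    simp
  have hiff : (Finsupp.single 0 a + Finsupp.single 1 b : Fin 2 →₀ ℕ) =
      Finsupp.single 0 r + Finsupp.single 1 r ↔ a = r ∧ b = r := by
    simp [Finsupp.ext_iff, Fin.forall_fin_two]
  rw [eps3, h, coeff_monomial]
  simp only [hiff]
  split_ifs with hab
  · rw [hab.2]
  · rfl

theorem eps3_X_pow_mul_neg_X_pow_mul_sum (r a b l : ℕ)
    (h : a + b + l = 2 * r + 1) :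
    eps3 r (X 0 ^ a * (-X 1) ^ b * ∑ j ∈ range l, X 0 ^ (l - 1 - j) * (-X 1) ^ j) =
      if a ≤ r ∧ b ≤ r then (-1) ^ r else 0 := by
  have hterm : ∀ j ∈ range l,
      eps3 r (X 0 ^ a * (-X 1) ^ b * (X 0 ^ (l - 1 - j) * (-X 1) ^ j)) =
        if b + j = r then (-1) ^ r else 0 := by
    intro j hj
    rw [mem_range] at hj
    rw [mul_mul_mul_comm, ← pow_add, ← pow_add, eps3_X_pow_mul_neg_X_pow]
    congr 1
    simp only [eq_iff_iff]
    omega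
  have hsum : eps3 r (X 0 ^ a * (-X 1) ^ b * ∑ j ∈ range l, X 0 ^ (l - 1 - j) * (-X 1) ^ j) =
      ∑ j ∈ range l, if b + j = r then (-1) ^ r else 0 := by
    rw [← sum_congr rfl hterm, mul_sum]
    simp only [eps3, coeff_sum]
  rw [hsum]
  split_ifs with hab
  · rw [sum_eq_single_of_mem (r - b) (mem_range.2 (by omega))
      (fun j _ hj => if_neg (by omega)), if_pos (by omega)]
  · refine sum_eq_zero fun j hj => if_neg ?_
    rw [mem_range] at hj
    omega

/-- for 1 ≤ lᵢ ≤ r, l₁+l₂+l₃ = 2r+1,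
ε( (x^{l₁} - (-y)^{l₁})(x^{l₂} - (-y)^{l₂}) Σ_{j=0}^{l₃-1} x^{l₃-1-j}(-y)^j ) = -2·(-1)^r. -/
theorem stmt_3 (r l₁ l₂ l₃ : ℕ) (hr : 1 ≤ r)
    (h1 : 1 ≤ l₁) (h1' : l₁ ≤ r) (h2 : 1 ≤ l₂) (h2' : l₂ ≤ r) (h3 : 1 ≤ l₃) (h3' : l₃ ≤ r)
    (hsum : l₁ + l₂ + l₃ = 2 * r + 1) :
    eps3 r ((X 0 ^ l₁ - (-X 1) ^ l₁) * (X 0 ^ l₂ - (-X 1) ^ l₂) *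
        ∑ j ∈ range l₃, X 0 ^ (l₃ - 1 - j) * (-X 1) ^ j)
      = -2 * (-1 : ℤ) ^ r := by
  have expand (u v s : MvPolynomial (Fin 2) ℤ) :
      (u ^ l₁ - v ^ l₁) * (u ^ l₂ - v ^ l₂) * s =
        u ^ (l₁ + l₂) * v ^ 0 * s - u ^ l₁ * v ^ l₂ * s - u ^ l₂ * v ^ l₁ * s +
          u ^ 0 * v ^ (l₁ + l₂) * s := by
    ring
  have eps3_expand (p q s t : MvPolynomial (Fin 2) ℤ) :
      eps3 r (p - q - s + t) = eps3 r p - eps3 r q - eps3 r s + eps3 r t := by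
    simp only [eps3, coeff_add, coeff_sub]
  rw [expand, eps3_expand]
  rw [eps3_X_pow_mul_neg_X_pow_mul_sum r _ _ l₃ (by omega),
    eps3_X_pow_mul_neg_X_pow_mul_sum r _ _ l₃ (by omega),
    eps3_X_pow_mul_neg_X_pow_mul_sum r _ _ l₃ (by omega),
    eps3_X_pow_mul_neg_X_pow_mul_sum r _ _ l₃ (by omega),
    if_neg (by omega), if_pos (by omega), if_pos (by omega), if_neg (by omega)]
  ring
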